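/- Let G be a minimal counterexample. Then for every subset R ⊆ I, the graph G − R obtained by deleting the vertices of R is connected. -/

import Mathlib

open SimpleGraph

noncomputable def edgeCount {V : Type*} (G : SimpleGraph V) : ℕ := Nat.card G.edgeSet

noncomputable def deg {V : Type*} (G : SimpleGraph V) (v : V) : ℕ := Nat.card (G.neighborSet v)

def TwoIndependent {V : Type*} (G : SimpleGraph V) (S : Set V) : Prop :=
  ∀ u ∈ S, ∀ v ∈ S, u ≠ v → ¬ G.Adj u v ∧ ∀ w, ¬ (G.Adj u w ∧ G.Adj w v)

def IsIFPartition {V : Type*} (G : SimpleGraph V) (A B : Set V) : Prop :=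
  A ∪ B = Set.univ ∧ Disjoint A B ∧ TwoIndependent G A ∧ (G.induce B).IsAcyclic

def IsAssignment {V : Type*} (I F U : Set V) : Prop :=
  I ∪ F ∪ U = Set.univ ∧ Disjoint I F ∧ Disjoint I U ∧ Disjoint F U

noncomputable def rho {V : Type*} (G : SimpleGraph V) (I F U : Set V) (H : G.Subgraph) : ℤ :=
  (H.verts ∩ I).ncard + 4 * (H.verts ∩ F).ncard + 5 * (H.verts ∩ U).ncard
    - 4 * Nat.card H.edgeSet

noncomputable def rhoSet {V : Type*} (G : SimpleGraph V) (I F U : Set V) (S : Set V) : ℤ :=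
  (S ∩ I).ncard + 4 * (S ∩ F).ncard + 5 * (S ∩ U).ncard - 4 * edgeCount (G.induce S)

def IsCounterexample {V : Type*} [Fintype V] (G : SimpleGraph V) (I F U : Set V) : Prop :=
  IsAssignment I F U ∧
  (∀ H : G.Subgraph, H.verts.Nonempty → 0 < rho G I F U H) ∧
  ¬ ∃ A B : Set V, IsIFPartition G A B ∧ I ⊆ A ∧ F ⊆ B

def IsMinCounterexample {V : Type*} [Fintype V] (G : SimpleGraph V) (I F U : Set V) : Prop :=
  IsCounterexample G I F U ∧
  ∀ (n : ℕ) (G' : SimpleGraph (Fin n)) (I' F' U' : Set (Fin n)),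
    IsCounterexample G' I' F' U' →
    Fintype.card V + edgeCount G ≤ n + edgeCount G'

def IsThread {V : Type*} (G : SimpleGraph V) (I F U : Set V) (p : List V) : Prop :=
  p ≠ [] ∧ p.Nodup ∧ p.Chain' G.Adj ∧ (∀ v ∈ p, v ∈ U ∧ deg G v = 2) ∧
  (∀ w, w ∉ p → (∃ a ∈ p, G.Adj a w) → 3 ≤ deg G w ∨ w ∈ I ∪ F)

def BordersThread {V : Type*} (G : SimpleGraph V) (p : List V) (w : V) : Prop :=
  w ∉ p ∧ ∃ a ∈ p, G.Adj a w

def IsStarForest {V : Type*} (H : SimpleGraph V) : Prop :=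
  H.IsAcyclic ∧ ∀ a b c d : V, H.Adj a b → H.Adj b c → H.Adj c d → a = c ∨ b = d

def IsStarColoring {V : Type*} {k : ℕ} (G : SimpleGraph V) (c : V → Fin k) : Prop :=
  (∀ u v, G.Adj u v → c u ≠ c v) ∧
  ∀ i j : Fin k, IsStarForest (G.induce {v | c v = i ∨ c v = j})

def StarColorable {V : Type*} (G : SimpleGraph V) (k : ℕ) : Prop :=
  ∃ c : V → Fin k, IsStarColoring G c

def MadLt {V : Type*} (G : SimpleGraph V) (q : ℚ) : Prop :=
  ∀ H : G.Subgraph, H.verts.Nonempty →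
    (2 * (Nat.card H.edgeSet : ℚ)) / (H.verts.ncard : ℚ) < q


lemma acyclic_glue {W : Type*} (K : SimpleGraph W) (P : Set W)
    (hP : ∀ u v, K.Adj u v → (u ∈ P ↔ v ∈ P))
    (h1 : (K.induce P).IsAcyclic) (h2 : (K.induce Pᶜ).IsAcyclic) : K.IsAcyclic := by
  have key : ∀ Q : Set W, (∀ u v, K.Adj u v → (u ∈ Q ↔ v ∈ Q)) → (K.induce Q).IsAcyclic →
      ∀ v ∈ Q, ∀ c : K.Walk v v, ¬ c.IsCycle := by
    intro Q hQ hac v hv c hc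
    have hs : ∀ {a b : W} (p : K.Walk a b), a ∈ Q → ∀ x ∈ p.support, x ∈ Q := by
      intro a b p
      induction p with
      | nil => intro ha x hx; simp at hx; exact hx ▸ ha
      | cons h p ih =>
        intro ha x hx
        simp only [Walk.support_cons, List.mem_cons] at hx
        rcases hx with rfl | hx
        · exact ha
        · exact ih ((hQ _ _ h).1 ha) x hx
    refine hac (c.induce Q (hs c hv)) ?_
    have hinj : Function.Injective (Embedding.induce (G := K) Q).toHom :=
      (Embedding.induce (G := K) Q).injective
    rw [← Walk.isCycle_map_iff_of_injective hinj, Walk.map_induce]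
    exact hc
  intro v c
  by_cases hv : v ∈ P
  · exact key P hP h1 v hv c
  · exact key Pᶜ (fun u v h => not_congr (hP u v h)) h2 v hv c

lemma restrict_min {V : Type*} [Fintype V] (G : SimpleGraph V)
    (I F U : Set V) (hmin : IsMinCounterexample G I F U) (S : Set V) (hS : S ≠ Set.univ) :
    ∃ A : Set V, A ⊆ S ∧ I ∩ S ⊆ A ∧ Disjoint F A ∧
      (∀ u ∈ A, ∀ v ∈ A, u ≠ v → ¬ G.Adj u v ∧ ∀ w ∈ S, ¬ (G.Adj u w ∧ G.Adj w v)) ∧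
      (G.induce (S \ A)).IsAcyclic := by
  classical
  obtain ⟨⟨hassign, hpot, -⟩, hle⟩ := hmin
  let e : Fin (Fintype.card S) ≃ S := (Fintype.equivFin S).symm
  let f : Fin (Fintype.card S) ↪ V := e.toEmbedding.trans (Function.Embedding.subtype _)
  have hfS : ∀ i, f i ∈ S := fun i => (e i).2
  have hfsurj : ∀ x ∈ S, ∃ i, f i = x := fun x hx =>
    ⟨e.symm ⟨x, hx⟩, by simp [f]⟩
  have hcard : Fintype.card S < Fintype.card V := by
    obtain ⟨x, hx⟩ := (Set.ne_univ_iff_exists_notMem S).1 hS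
    exact Fintype.card_subtype_lt hx
  let G' := G.comap f
  have hedge : edgeCount G' ≤ edgeCount G :=
    Nat.card_le_card_of_injective _ (Embedding.comap f G).mapEdgeSet.injective
  have hnot : ¬ IsCounterexample G' (f ⁻¹' I) (f ⁻¹' F) (f ⁻¹' U) := by
    intro hc
    have := hle _ _ _ _ _ hc
    omega
  have hex : ∃ A B : Set _, IsIFPartition G' A B ∧ f ⁻¹' I ⊆ A ∧ f ⁻¹' F ⊆ B := by
    by_contra hcon
    refine hnot ⟨⟨?_, hassign.2.1.preimage f, hassign.2.2.1.preimage f,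
      hassign.2.2.2.preimage f⟩, ?_, hcon⟩
    · rw [← Set.preimage_union, ← Set.preimage_union, hassign.1, Set.preimage_univ]
    · intro H hH
      have h := hpot (H.map (Embedding.comap f G).toHom) (by simpa using hH)
      have hn : ∀ T : Set V, ((H.map (Embedding.comap f G).toHom).verts ∩ T).ncard
          = (H.verts ∩ f ⁻¹' T).ncard := by
        intro T
        have : (H.map (Embedding.comap f G).toHom).verts ∩ T = f '' (H.verts ∩ f ⁻¹' T) := by
          rw [Set.image_inter_preimage]; rfl
        rw [this, Set.ncard_image_of_injective _ f.injective]
      have he : Nat.card (H.map (Embedding.comap f G).toHom).edgeSet = Nat.card H.edgeSet := by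
        rw [Subgraph.edgeSet_map]
        exact Nat.card_image_of_injective (Sym2.map.injective f.injective) _
      unfold rho at h ⊢
      rw [hn, hn, hn, he] at h
      exact h
  obtain ⟨A, B, ⟨hun, hdis, htwo, hac⟩, hIA, hFB⟩ := hex
  refine ⟨f '' A, ?_, ?_, ?_, ?_, ?_⟩
  · rintro _ ⟨i, -, rfl⟩; exact hfS i
  · rintro x ⟨hx, hxS⟩
    obtain ⟨i, rfl⟩ := hfsurj x hxS
    exact ⟨i, hIA hx, rfl⟩
  · rw [Set.disjoint_left]
    rintro _ hx ⟨i, hi, rfl⟩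
    exact Set.disjoint_left.1 hdis hi (hFB hx)
  · rintro _ ⟨i, hi, rfl⟩ _ ⟨j, hj, rfl⟩ hij
    obtain ⟨h1, h2⟩ := htwo i hi j hj (fun h => hij (h ▸ rfl))
    refine ⟨h1, ?_⟩
    intro w hw
    obtain ⟨k, rfl⟩ := hfsurj w hw
    exact h2 k
  · have hmem : ∀ x : ↥(S \ f '' A), e.symm ⟨x.1, x.2.1⟩ ∈ B := by
      intro x
      have : e.symm ⟨x.1, x.2.1⟩ ∈ A ∪ B := hun ▸ Set.mem_univ _
      rcases this with h | h
      · exact absurd ⟨_, h, by simp [f]⟩ x.2.2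
      · exact h
    refine IsAcyclic.comap (G' := G'.induce B)
      ⟨fun x => ⟨e.symm ⟨x.1, x.2.1⟩, hmem x⟩, ?_⟩ ?_ hac
    · intro x y h
      simpa [G', f] using h
    · intro x y h
      have h' := congrArg (fun z => (e z.1).1) h
      simpa [Subtype.ext_iff] using h'

/-- In a minimal counterexample, deleting any subset `R ⊆ I` leaves a connected graph. -/
theorem connected_of_delete_subset_of_I {V : Type*} [Fintype V] (G : SimpleGraph V)
    (I F U : Set V) (hmin : IsMinCounterexample G I F U) :
    ∀ R : Set V, R ⊆ I → (G.induce Rᶜ).Connected := by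
  classical
  intro R hR
  have hno := hmin.1.2.2
  have hIF := hmin.1.1.2.1
  rw [connected_iff]
  constructor
  swap
  · by_contra hemp
    have hRall : ∀ v, v ∈ R := by
      intro v
      by_contra hv
      exact hemp ⟨⟨v, hv⟩⟩
    have hIu : I = Set.univ := Set.eq_univ_of_forall fun v => hR (hRall v)
    have hFe : F = ∅ := by
      rw [hIu] at hIF; simpa using hIF
    have hUe : U = ∅ := by
      have := hmin.1.1.2.2.1
      rw [hIu] at this; simpa using this
    have hnadj : ∀ u v, ¬ G.Adj u v := by
      intro u v h
      have hp := hmin.1.2.1 (G.subgraphOfAdj h) ⟨u, by simp⟩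
      unfold rho at hp
      rw [hIu, hFe, hUe] at hp
      simp [Set.ncard_pair h.ne] at hp
    refine hno ⟨Set.univ, ∅, ⟨by simp, by simp, ?_, ?_⟩, by simp, by simp [hFe]⟩
    · intro u _ v _ _
      exact ⟨hnadj u v, fun w h => hnadj _ _ h.1⟩
    · exact IsAcyclic.of_subsingleton
  · intro a b
    by_contra hab
    let X : Set V := {v | ∃ h : v ∈ Rᶜ, (G.induce Rᶜ).Reachable a ⟨v, h⟩}
    have hXR : ∀ v ∈ X, v ∉ R := fun v hv => hv.1
    have hX : ∀ u v, G.Adj u v → u ∈ X → v ∉ R → v ∈ X := by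
      rintro u v huv ⟨hu, hr⟩ hv
      refine ⟨hv, hr.trans (Adj.reachable ?_)⟩
      exact huv
    have haX : a.1 ∈ X := ⟨a.2, Reachable.refl _⟩
    have hbX : b.1 ∉ X := fun h => hab h.2
    obtain ⟨A1, hA1S, hA1I, hA1F, hA1, hac1⟩ := restrict_min G I F U hmin (X ∪ R) (by
      intro h
      have : b.1 ∈ X ∪ R := h ▸ Set.mem_univ _
      exact this.elim hbX b.2)
    obtain ⟨A2, hA2S, hA2I, hA2F, hA2, hac2⟩ := restrict_min G I F U hmin Xᶜ (by
      intro h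
      have : a.1 ∈ Xᶜ := h ▸ Set.mem_univ _
      exact this haX)
    have hRA1 : ∀ r ∈ R, r ∈ A1 := fun r hr => hA1I ⟨hR hr, Or.inr hr⟩
    have hRA2 : ∀ r ∈ R, r ∈ A2 := fun r hr => hA2I ⟨hR hr, fun h => hXR r h hr⟩
    refine hno ⟨A1 ∪ A2, (A1 ∪ A2)ᶜ, ⟨Set.union_compl_self _, disjoint_compl_right, ?_, ?_⟩, ?_, ?_⟩
    · -- membership normal form
      have m1 : ∀ x ∈ A1 ∪ A2, x ∈ X ∪ R → x ∈ A1 := by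
        rintro x (h | h) hx
        · exact h
        · exact hx.elim (fun hx => absurd hx (hA2S h)) (hRA1 x)
      have m2 : ∀ x ∈ A1 ∪ A2, x ∉ X → x ∈ A2 := by
        rintro x (h | h) hx
        · exact (hA1S h).elim (fun h => absurd h hx) (hRA2 x)
        · exact h
      -- every edge lies in one of the two sides
      have nadj : ∀ u ∈ A1 ∪ A2, ∀ v ∈ A1 ∪ A2, ¬ G.Adj u v := by
        intro u hu v hv h
        by_cases hu1 : u ∈ X
        · have hv1 : v ∈ X ∪ R := by
            by_cases hvR : v ∈ R
            · exact Or.inr hvR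
            · exact Or.inl (hX u v h hu1 hvR)
          exact (hA1 u (m1 u hu (Or.inl hu1)) v (m1 v hv hv1) h.ne).1 h
        · by_cases hv1 : v ∈ X
          · have hu2 : u ∈ X ∪ R := by
              by_cases huR : u ∈ R
              · exact Or.inr huR
              · exact Or.inl (hX v u h.symm hv1 huR)
            exact (hA1 u (m1 u hu hu2) v (m1 v hv (Or.inl hv1)) h.ne).1 h
          · exact (hA2 u (m2 u hu hu1) v (m2 v hv hv1) h.ne).1 h
      intro u hu v hv huv
      refine ⟨nadj u hu v hv, ?_⟩
      rintro w ⟨h1, h2⟩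
      have hwR : w ∉ R := fun h => nadj u hu w (Or.inl (hRA1 w h)) h1
      by_cases hw : w ∈ X
      · have q : ∀ z, G.Adj w z → z ∈ X ∪ R := by
          intro z hz
          by_cases hzR : z ∈ R
          · exact Or.inr hzR
          · exact Or.inl (hX w z hz hw hzR)
        exact (hA1 u (m1 u hu (q u h1.symm)) v (m1 v hv (q v h2)) huv).2 w (Or.inl hw) ⟨h1, h2⟩
      · have q : ∀ z, G.Adj w z → z ∉ X := fun z hz hzX => hw (hX z w hz.symm hzX hwR)
        exact (hA2 u (m2 u hu (q u h1.symm)) v (m2 v hv (q v h2)) huv).2 w hw ⟨h1, h2⟩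
    · have nR : ∀ x : ↥(A1 ∪ A2)ᶜ, x.1 ∉ R := fun x h => x.2 (Or.inl (hRA1 _ h))
      apply acyclic_glue _ {x | x.1 ∈ X}
      · intro u v h
        exact ⟨fun hu => hX _ _ h hu (nR v), fun hv => hX _ _ h.symm hv (nR u)⟩
      · refine IsAcyclic.comap (G' := G.induce ((X ∪ R) \ A1))
          ⟨fun x => ⟨x.1.1, Or.inl x.2, fun h => x.1.2 (Or.inl h)⟩, ?_⟩ ?_ hac1
        · intro x y h; exact h
        · intro x y h
          exact Subtype.ext (Subtype.ext (congrArg (fun z => z.1) h))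
      · refine IsAcyclic.comap (G' := G.induce (Xᶜ \ A2))
          ⟨fun x => ⟨x.1.1, x.2, fun h => x.1.2 (Or.inr h)⟩, ?_⟩ ?_ hac2
        · intro x y h; exact h
        · intro x y h
          exact Subtype.ext (Subtype.ext (congrArg (fun z => z.1) h))
    · intro x hx
      by_cases h : x ∈ X
      · exact Or.inl (hA1I ⟨hx, Or.inl h⟩)
      · exact Or.inr (hA2I ⟨hx, h⟩)
    · intro x hx h
      exact h.elim (Set.disjoint_left.1 hA1F hx) (Set.disjoint_left.1 hA2F hx)
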